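/- There exists a (Σ¹₂,Σ¹₁∪Π¹₁)-expansion of the Cantor space 2^ℕ; in fact one can take Y' = 2^ℕ × 2^ℕ with its standard clopen subbase: there are a Σ¹₂ set E ⊆ 2^ℕ × 2^ℕ and a Σ¹₂-measurable map r : E → 2^ℕ such that for every Σ¹₁∪Π¹₁-submeasurable f : 2^ℕ × 2^ℕ → 2^ℕ there exist a set F ⊆ E closed in 2^ℕ × 2^ℕ and a continuous g : 2^ℕ → 2^ℕ with r(F) = 2^ℕ and g(r(w)) = f(w) for all w ∈ F. -/

import Mathlib

open MeasureTheory TopologicalSpace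

/-- The space `[ω]^ω` of infinite subsets of `ℕ`, topologized as a subspace of the
Cantor space `ℕ → Bool` via characteristic functions. -/
abbrev IOI := {x : ℕ → Bool // {n | x n = true}.Infinite}

/-- A set is `Σ¹₂` if it is the image of a coanalytic subset of Baire space under a
continuous map. -/
def Sigma12 {X : Type*} [TopologicalSpace X] (A : Set X) : Prop :=
  ∃ (C : Set (ℕ → ℕ)) (f : (ℕ → ℕ) → X),
    MeasureTheory.AnalyticSet Cᶜ ∧ Continuous f ∧ f '' C = A

/-- A topological space is zero-dimensional if it has a basis of clopen sets. -/
def ZeroDim (X : Type*) [TopologicalSpace X] : Prop :=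
  ∃ b : Set (Set X), (∀ s ∈ b, IsClopen s) ∧ TopologicalSpace.IsTopologicalBasis b

/-- `A` is `Σ¹₂`-complete: `A` is `Σ¹₂` and every `Σ¹₂` subset of a zero-dimensional
Polish space is a continuous preimage of `A`. -/
def Sigma12Complete {X : Type*} [TopologicalSpace X] (A : Set X) : Prop :=
  Sigma12 A ∧
  ∀ (Z : Type) [TopologicalSpace Z] [PolishSpace Z], ZeroDim Z →
    ∀ B : Set Z, Sigma12 B → ∃ f : Z → X, Continuous f ∧ f ⁻¹' A = B

/-- `f` into the Cantor space is `Σ¹₁∪Π¹₁`-submeasurable (w.r.t. the standard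
subbase `{x : x(n) = i}`): each such preimage is analytic or coanalytic. -/
def CantorSubmeasurable {Z : Type*} [TopologicalSpace Z] (f : Z → (ℕ → Bool)) : Prop :=
  ∀ (n : ℕ) (i : Bool),
    AnalyticSet (f ⁻¹' {x | x n = i}) ∨ AnalyticSet (f ⁻¹' {x | x n = i})ᶜ

namespace Sigma12

variable {X Y : Type*} [TopologicalSpace X] [TopologicalSpace Y]

theorem image {A : Set X} (hA : Sigma12 A) {f : X → Y} (hf : Continuous f) :
    Sigma12 (f '' A) := by
  obtain ⟨C, k, hC, hk, rfl⟩ := hA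
  exact ⟨C, f ∘ k, hC, hf.comp hk, Set.image_comp f k C⟩

theorem of_coanalytic [PolishSpace X] [Nonempty X] {C : Set X} (hC : AnalyticSet Cᶜ) :
    Sigma12 C := by
  obtain ⟨k, hk, hsurj⟩ := PolishSpace.exists_nat_nat_continuous_surjective X
  exact ⟨k ⁻¹' C, k, hC.preimage hk, hk, Set.image_preimage_eq C hsurj⟩

theorem of_analytic [Nonempty X] {A : Set X} (hA : AnalyticSet A) : Sigma12 A := by
  rw [AnalyticSet] at hA
  rcases hA with rfl | ⟨k, hk, rfl⟩
  · have h : Sigma12 (∅ : Set (ℕ → ℕ)) :=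
      of_coanalytic (by rw [Set.compl_empty]; exact isClosed_univ.analyticSet)
    simpa using h.image (continuous_const (y := Classical.arbitrary X))
  · have h : Sigma12 (Set.univ : Set (ℕ → ℕ)) :=
      of_coanalytic (by rw [Set.compl_univ]; exact analyticSet_empty)
    simpa using h.image hk

theorem iUnion {A : ℕ → Set X} (hA : ∀ n, Sigma12 (A n)) : Sigma12 (⋃ n, A n) := by
  choose C k hC hk hCk using hA
  have h : Sigma12 {p : ℕ × (ℕ → ℕ) | p.2 ∈ C p.1} := by
    apply of_coanalytic
    have : {p : ℕ × (ℕ → ℕ) | p.2 ∈ C p.1}ᶜ = ⋃ n, (fun w => (n, w)) '' (C n)ᶜ := by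
      ext ⟨n, w⟩
      simp
    rw [this]
    exact AnalyticSet.iUnion fun n => (hC n).image_of_continuous (by fun_prop)
  have hc : Continuous fun p : ℕ × (ℕ → ℕ) => k p.1 p.2 :=
    continuous_prod_of_discrete_left.2 hk
  convert h.image hc
  ext x
  simp [← hCk]

theorem iInter [T2Space X] {A : ℕ → Set X} (hA : ∀ n, Sigma12 (A n)) :
    Sigma12 (⋂ n, A n) := by
  choose C k hC hk hCk using hA
  have h : Sigma12 {w : ℕ → ℕ → ℕ | ∀ n, w n ∈ C n ∧ k n (w n) = k 0 (w 0)} := by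
    apply of_coanalytic
    have : {w : ℕ → ℕ → ℕ | ∀ n, w n ∈ C n ∧ k n (w n) = k 0 (w 0)}ᶜ =
        (⋃ n, (fun w => w n) ⁻¹' (C n)ᶜ) ∪
          ⋃ n, {w : ℕ → ℕ → ℕ | k n (w n) ≠ k 0 (w 0)} := by
      ext w
      simp only [Set.mem_compl_iff, Set.mem_ofPred_eq, Set.mem_union, Set.mem_iUnion,
        Set.mem_preimage, ne_eq]
      grind
    rw [this, Set.union_eq_iUnion]
    refine AnalyticSet.iUnion fun b => ?_
    cases b
    · refine AnalyticSet.iUnion fun n => ?_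
      have ho : IsOpen {w : ℕ → ℕ → ℕ | k n (w n) ≠ k 0 (w 0)} :=
        isOpen_ne_fun ((hk n).comp (continuous_apply n)) ((hk 0).comp (continuous_apply 0))
      simpa using ho.analyticSet_image continuous_id
    · exact AnalyticSet.iUnion fun n => (hC n).preimage (continuous_apply n)
  have hc : Continuous fun w : ℕ → ℕ → ℕ => k 0 (w 0) := (hk 0).comp (continuous_apply 0)
  convert h.image hc
  ext x
  simp only [Set.mem_iInter, ← hCk, Set.mem_image, Set.mem_ofPred_eq]
  constructor
  · intro hx
    choose w hw hwx using hx
    exact ⟨w, fun n => ⟨hw n, (hwx n).trans (hwx 0).symm⟩, hwx 0⟩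
  · rintro ⟨w, hw, rfl⟩ n
    exact ⟨w n, hw n⟩

theorem inter [T2Space X] {A B : Set X} (hA : Sigma12 A) (hB : Sigma12 B) :
    Sigma12 (A ∩ B) := by
  have h : A ∩ B = ⋂ n : ℕ, if n = 0 then A else B := by
    ext x
    simp only [Set.mem_inter_iff, Set.mem_iInter]
    refine ⟨fun hx n => by split_ifs <;> simp [hx], fun hx => ⟨by simpa using hx 0, ?_⟩⟩
    simpa using hx 1
  rw [h]
  exact iInter fun n => by split_ifs <;> assumption

theorem preimage [PolishSpace X] [Nonempty X] [T2Space Y] {B : Set Y} (hB : Sigma12 B)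
    {f : X → Y} (hf : Continuous f) : Sigma12 (f ⁻¹' B) := by
  obtain ⟨C, k, hC, hk, rfl⟩ := hB
  have h₁ : Sigma12 {p : X × (ℕ → ℕ) | p.2 ∈ C} := of_coanalytic (hC.preimage continuous_snd)
  have h₂ : Sigma12 {p : X × (ℕ → ℕ) | k p.2 = f p.1} :=
    of_analytic (isClosed_eq (hk.comp continuous_snd) (hf.comp continuous_fst)).analyticSet
  convert (h₁.inter h₂).image continuous_fst
  ext x
  simp

end Sigma12

/-- The σ-algebra of sets which are both `Σ¹₂` and `Π¹₂`. -/
@[reducible] def delta12 (X : Type*) [TopologicalSpace X] [PolishSpace X] [Nonempty X] :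
    MeasurableSpace X where
  MeasurableSet' A := Sigma12 A ∧ Sigma12 Aᶜ
  measurableSet_empty :=
    ⟨.of_analytic analyticSet_empty, .of_coanalytic (by simpa using analyticSet_empty)⟩
  measurableSet_compl A hA := ⟨hA.2, by simpa using hA.1⟩
  measurableSet_iUnion A hA :=
    ⟨.iUnion fun n => (hA n).1, by rw [Set.compl_iUnion]; exact .iInter fun n => (hA n).2⟩

section Delta12

variable {X Y : Type*} [TopologicalSpace X] [PolishSpace X] [Nonempty X] [TopologicalSpace Y]

theorem MeasureTheory.AnalyticSet.measurableSet_delta12 {A : Set X} (hA : AnalyticSet A) :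
    MeasurableSet[delta12 X] A :=
  ⟨.of_analytic hA, .of_coanalytic (by rwa [compl_compl])⟩

theorem borel_le_delta12 : borel X ≤ delta12 X :=
  MeasurableSpace.generateFrom_le fun _ hU =>
    ((IsOpen.isClosed_compl hU).analyticSet.measurableSet_delta12).of_compl

theorem Continuous.measurable_delta12 [MeasurableSpace Y] [BorelSpace Y] {f : X → Y}
    (hf : Continuous f) : Measurable[delta12 X] f := by
  borelize X
  exact hf.measurable.mono (BorelSpace.measurable_eq.trans_le borel_le_delta12) le_rfl

theorem Continuous.measurable_delta12_delta12 [PolishSpace Y] [Nonempty Y] {f : X → Y}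
    (hf : Continuous f) : Measurable[delta12 X, delta12 Y] f :=
  fun _ hB => ⟨hB.1.preimage hf, hB.2.preimage hf⟩

theorem Measurable.sigma12_preimage [PolishSpace Y] [MeasurableSpace Y] [BorelSpace Y] {f : X → Y}
    (hf : Measurable[delta12 X] f) {B : Set Y} (hB : Sigma12 B) : Sigma12 (f ⁻¹' B) := by
  obtain ⟨C, k, hC, hk, rfl⟩ := hB
  have h₁ : Sigma12 {p : X × (ℕ → ℕ) | p.2 ∈ C} :=
    .of_coanalytic (hC.preimage continuous_snd)
  have h₂ : MeasurableSet[delta12 (X × (ℕ → ℕ))] {p : X × (ℕ → ℕ) | k p.2 = f p.1} :=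
    measurableSet_eq_fun (hk.comp continuous_snd).measurable_delta12
      (hf.comp continuous_fst.measurable_delta12_delta12)
  convert (h₁.inter h₂.1).image continuous_fst
  ext x
  simp

theorem Measurable.measurable_delta12 [PolishSpace Y] [Nonempty Y] [MeasurableSpace Y]
    [BorelSpace Y] {f : X → Y} (hf : Measurable[delta12 X] f) : Measurable[delta12 X, delta12 Y] f :=
  fun _ hB => ⟨hf.sigma12_preimage hB.1, hf.sigma12_preimage hB.2⟩

open PiNat in
/-- Jankov–von Neumann uniformization: an analytic relation has a uniformizing function, the
leftmost branch of a tree representation, which is measurable for the `Δ¹₂` sets. -/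
theorem MeasureTheory.AnalyticSet.exists_uniformization [Nonempty Y] [MeasurableSpace Y]
    [BorelSpace Y] {R : Set (X × Y)} (hR : AnalyticSet R) :
    ∃ φ : X → Y, Measurable[delta12 X] φ ∧ ∀ x y, (x, y) ∈ R → (x, φ x) ∈ R := by
  classical
  rw [AnalyticSet] at hR
  rcases hR with rfl | ⟨k, hk, rfl⟩
  · exact ⟨fun _ => Classical.arbitrary Y, measurable_const, by simp⟩
  let S : List ℕ → Set X := fun l => {x | ∃ v, (k v).1 = x ∧ res v l.length = l}
  have hS : ∀ l, MeasurableSet[delta12 X] (S l) := by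
    intro l
    apply AnalyticSet.measurableSet_delta12
    have ho : IsOpen {v : ℕ → ℕ | res v l.length = l} := by
      by_cases h : ∃ u : ℕ → ℕ, res u l.length = l
      · obtain ⟨u, hu⟩ := h
        convert isOpen_cylinder (fun _ => ℕ) u l.length
        rw [cylinder_eq_res]
        simp [hu]
      · convert isOpen_empty
        ext v
        simpa using fun hv => h ⟨v, hv⟩
    convert ho.analyticSet_image (continuous_fst.comp hk)
    ext x
    simp [S, and_comm]
  obtain ⟨H, hH, hHS⟩ : ∃ H : List ℕ → X → ℕ, (∀ l, Measurable[delta12 X] (H l)) ∧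
      ∀ l x, x ∈ S (H l x :: l) ∨ ∀ j, x ∉ S (j :: l) := by
    have hex : ∀ l x, ∃ m, x ∈ S (m :: l) ∨ ∀ j, x ∉ S (j :: l) := by
      intro l x
      by_cases h : ∃ m, x ∈ S (m :: l)
      · exact h.imp fun _ => Or.inl
      · exact ⟨0, Or.inr (not_exists.1 h)⟩
    refine ⟨fun l x => Nat.find (hex l x), fun l => ?_, fun l x => Nat.find_spec (hex l x)⟩
    refine @measurable_find X (delta12 X) _ _ (hex l) fun m => ?_
    have : {x | x ∈ S (m :: l) ∨ ∀ j, x ∉ S (j :: l)} =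
        S (m :: l) ∪ ⋂ j, (S (j :: l))ᶜ := by ext; simp
    rw [this]
    exact (hS _).union (MeasurableSet.iInter fun j => (hS _).compl)
  obtain ⟨P, hP_zero, hP_succ⟩ : ∃ P : ℕ → X → List ℕ,
      P 0 = (fun _ => []) ∧ ∀ n, P (n + 1) = fun x => H (P n x) x :: P n x :=
    ⟨fun n => Nat.rec (fun _ => []) (fun _ p x => H (p x) x :: p x) n, rfl, fun _ => rfl⟩
  let b : X → ℕ → ℕ := fun x n => H (P n x) x
  let : MeasurableSpace (List ℕ) := ⊤
  have hHP : ∀ n, Measurable[delta12 X] (P n) →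
      Measurable[delta12 X] (fun x => H (P n x) x) := by
    intro n hn
    let := delta12 X
    exact (measurable_from_prod_countable_right
      (f := fun q : List ℕ × X => H q.1 q.2) hH).comp (hn.prodMk measurable_id)
  have hP : ∀ n, Measurable[delta12 X] (P n) := by
    intro n
    induction n with
    | zero => rw [hP_zero]; exact measurable_const
    | succ n ih =>
      rw [hP_succ]
      have hcons : Measurable fun q : ℕ × List ℕ => q.1 :: q.2 := .of_discrete
      let := delta12 X
      exact hcons.comp ((hHP n ih).prodMk ih)
  have hb : Measurable[delta12 X] b :=
    @measurable_pi_lambda _ _ _ (delta12 X) _ _ fun n => hHP n (hP n)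
  have hPb : ∀ n x, P n x = res (b x) n := by
    intro n x
    induction n with
    | zero => rw [hP_zero, res_zero]
    | succ n ih => rw [res_succ, ← ih, hP_succ]
  refine ⟨fun x => (k (b x)).2, (continuous_snd.comp hk).measurable.comp hb, ?_⟩
  rintro x y ⟨v₀, hv₀⟩
  have hPS : ∀ n, x ∈ S (P n x) := by
    intro n
    induction n with
    | zero => exact ⟨v₀, by simp [hv₀], by simp [hP_zero]⟩
    | succ n ih =>
      rcases hHS (P n x) x with h | h
      · rwa [hP_succ]
      · obtain ⟨v, hv, hvl⟩ := ih
        refine absurd ⟨v, hv, ?_⟩ (h (v (P n x).length))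
        simp [res_succ, hvl]
  have hbx : (k (b x)).1 = x := by
    choose v hvx hv using hPS
    have hlim : Filter.Tendsto v Filter.atTop (nhds (b x)) := by
      rw [tendsto_pi_nhds]
      intro i
      refine tendsto_const_nhds.congr' ?_
      filter_upwards [Filter.eventually_gt_atTop i] with n hn
      have := hv n
      rw [hPb, res_length] at this
      exact (res_eq_res.1 this hn).symm
    refine tendsto_nhds_unique
      ((continuous_fst.comp hk).continuousAt.tendsto.comp hlim) ?_
    simp [Function.comp_def, hvx]
  exact ⟨b x, by ext <;> simp [hbx]⟩

end Delta12

section PerfectSet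

open CantorScheme PiNat Set

variable {T Y : Type*}

/-- A relatively open piece of a set on which `p` is nowhere locally constant inherits this
property, and so does the closure of that piece. -/
theorem exists_ne_of_mem_closure_inter [TopologicalSpace T] {p : T → Y} {C O : Set T}
    (hC : ∀ τ ∈ C, ∀ U, IsOpen U → τ ∈ U → ∃ σ ∈ C ∩ U, p σ ≠ p τ) (hO : IsOpen O) :
    ∀ τ ∈ closure (O ∩ C), ∀ U, IsOpen U → τ ∈ U → ∃ σ ∈ closure (O ∩ C) ∩ U, p σ ≠ p τ := by
  intro τ hτ U hU hτU
  obtain ⟨σ, hσU, hσO, hσC⟩ := mem_closure_iff.1 hτ U hU hτU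
  by_cases hne : p σ = p τ
  · obtain ⟨ρ, ⟨hρC, hρO, hρU⟩, hρ⟩ := hC σ hσC (O ∩ U) (hO.inter hU) ⟨hσO, hσU⟩
    exact ⟨ρ, ⟨subset_closure ⟨hρO, hρC⟩, hρU⟩, hne ▸ hρ⟩
  · exact ⟨σ, ⟨subset_closure ⟨hσO, hσC⟩, hσU⟩, hne⟩

theorem exists_cantor_embedding_of_nowhere_const [MetricSpace T] [CompleteSpace T]
    [TopologicalSpace Y] [T25Space Y] {p : T → Y} (hp : Continuous p) {K : Set T} (hK : IsClosed K)
    (hne : K.Nonempty) (hKp : ∀ τ ∈ K, ∀ U, IsOpen U → τ ∈ U → ∃ σ ∈ K ∩ U, p σ ≠ p τ) :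
    ∃ f : (ℕ → Bool) → T, Continuous f ∧ (∀ c, f c ∈ K) ∧ Function.Injective (p ∘ f) := by
  obtain ⟨u, -, upos', hu⟩ := exists_seq_strictAnti_tendsto' (zero_lt_one' ENNReal)
  have upos := fun n => (upos' n).1
  let Good : Set T → Prop := fun C =>
    (∀ τ ∈ C, ∀ U, IsOpen U → τ ∈ U → ∃ σ ∈ C ∩ U, p σ ≠ p τ) ∧ IsClosed C ∧ C.Nonempty
  have split : ∀ (C : Set T) (n : ℕ), Good C → ∃ D : Bool → Set T, (∀ i, Good (D i)) ∧
      (∀ i, D i ⊆ C) ∧ (∀ i, Metric.ediam (D i) ≤ u n) ∧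
      Disjoint (p '' D false) (p '' D true) := by
    rintro C n ⟨hC, hcl, τ₀, hτ₀⟩
    obtain ⟨τ₁, ⟨hτ₁, -⟩, hτ⟩ := hC τ₀ hτ₀ univ isOpen_univ trivial
    obtain ⟨V₁, hτV₁, hV₁, V₀, hτV₀, hV₀, hdisj⟩ := exists_open_nhds_disjoint_closure hτ
    let τ : Bool → T := fun i => if i then τ₁ else τ₀
    let V : Bool → Set Y := fun i => if i then V₁ else V₀
    have hV : ∀ i, IsOpen (V i) := by rintro (_ | _) <;> simp [V, hV₀, hV₁]
    have hτV : ∀ i, p (τ i) ∈ V i := by rintro (_ | _) <;> simp [V, τ, hτV₀, hτV₁]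
    have hτC : ∀ i, τ i ∈ C := by rintro (_ | _) <;> simp [τ, hτ₀, hτ₁]
    let O : Bool → Set T := fun i => Metric.eball (τ i) (u n / 2) ∩ p ⁻¹' V i
    have hO : ∀ i, IsOpen (O i) := fun i => Metric.isOpen_eball.inter ((hV i).preimage hp)
    have hpV : ∀ i, p '' closure (O i ∩ C) ⊆ closure (V i) := fun i =>
      (image_closure_subset_closure_image hp).trans <| closure_mono <| by
        rintro _ ⟨σ, ⟨⟨-, hσ⟩, -⟩, rfl⟩
        exact hσ
    refine ⟨fun i => closure (O i ∩ C), fun i =>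
      ⟨exists_ne_of_mem_closure_inter hC (hO i), isClosed_closure, ?_⟩, fun i => ?_, fun i => ?_,
      hdisj.symm.mono (hpV false) (hpV true)⟩
    · refine ⟨τ i, subset_closure ⟨⟨Metric.mem_eball_self ?_, hτV i⟩, hτC i⟩⟩
      exact ENNReal.half_pos (upos n).ne'
    · exact closure_minimal inter_subset_right hcl
    · rw [Metric.ediam_closure]
      refine (Metric.ediam_mono (inter_subset_left.trans inter_subset_left)).trans ?_
      refine Metric.ediam_eball_le.trans ?_
      rw [mul_comm, ENNReal.div_mul_cancel (by norm_num) (by norm_num)]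
  choose! D hDgood hDsub hDdiam hDdisj using split
  let A : List Bool → Set T := fun l => List.rec K (fun i l C => D C (l.length + 1) i) l
  have hA_cons : ∀ i l, A (i :: l) = D (A l) (l.length + 1) i := fun _ _ => rfl
  have hA : ∀ l, Good (A l) := by
    intro l
    induction l with
    | nil => exact ⟨hKp, hK, hne⟩
    | cons i l ih => exact hDgood _ _ ih i
  have hanti : ClosureAntitone A :=
    Antitone.closureAntitone (fun l i => hDsub _ _ (hA l) i) fun l => (hA l).2.1
  have hdiam : VanishingDiam A := by
    intro x
    refine tendsto_of_tendsto_of_tendsto_of_le_of_le' tendsto_const_nhds hu (by simp) ?_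
    filter_upwards [Filter.eventually_ge_atTop 1] with m hm
    obtain ⟨n, rfl⟩ := Nat.exists_eq_add_of_le' hm
    rw [res_succ, hA_cons, res_length]
    exact hDdiam _ _ (hA _) _
  have hdom : ∀ x : ℕ → Bool, x ∈ (inducedMap A).1 := fun x => by
    rw [hanti.map_of_vanishingDiam hdiam fun l => (hA l).2.2]
    trivial
  refine ⟨fun x => (inducedMap A).2 ⟨x, hdom x⟩,
    hdiam.map_continuous.comp (by fun_prop), fun x => map_mem ⟨x, hdom x⟩ 0, ?_⟩
  have hdisj : CantorScheme.Disjoint fun l => p '' A l := by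
    rintro l (_ | _) (_ | _) hij <;> try contradiction
    · exact hDdisj _ _ (hA l)
    · exact (hDdisj _ _ (hA l)).symm
  have hdom' : ∀ x : ℕ → Bool, p ((inducedMap A).2 ⟨x, hdom x⟩) ∈ ⋂ n, p '' A (res x n) :=
    fun x => mem_iInter.2 fun n => mem_image_of_mem p (map_mem ⟨x, hdom x⟩ n)
  intro x y hxy
  by_contra hne
  have hres : res x (firstDiff x y) = res y (firstDiff x y) :=
    res_eq_res.2 fun m hm => apply_eq_of_lt_firstDiff hm
  have hx := mem_iInter.1 (hdom' x) (firstDiff x y + 1)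
  have hy := mem_iInter.1 (hdom' y) (firstDiff x y + 1)
  rw [res_succ] at hx hy
  rw [← hres] at hy
  rw [show p _ = p _ from hxy.symm] at hy
  exact Set.disjoint_left.1 (hdisj _ (apply_firstDiff_ne hne)) hx hy

/-- The perfect set property of analytic sets, in a form which also lifts the perfect set along
a given continuous map. -/
theorem IsClosed.exists_injective_comp_of_not_countable_image [TopologicalSpace T] [PolishSpace T]
    [TopologicalSpace Y] [T25Space Y] {p : T → Y} (hp : Continuous p) {K : Set T} (hK : IsClosed K)
    (hunc : ¬(p '' K).Countable) :
    ∃ f : (ℕ → Bool) → T, Continuous f ∧ (∀ c, f c ∈ K) ∧ Function.Injective (p ∘ f) := by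
  let := upgradeIsCompletelyMetrizable T
  let 𝒪 : Set (Set T) := {O ∈ countableBasis T | (p '' (K ∩ O)).Countable}
  have h𝒪 : (p '' (K ∩ ⋃₀ 𝒪)).Countable := by
    rw [sUnion_eq_biUnion, inter_iUnion₂, image_iUnion₂]
    exact ((countable_countableBasis T).mono fun _ h => h.1).biUnion fun _ h => h.2
  have hopen : IsOpen (⋃₀ 𝒪) :=
    isOpen_sUnion fun O hO => (isBasis_countableBasis T).isOpen hO.1
  have hsplit : p '' K = p '' (K \ ⋃₀ 𝒪) ∪ p '' (K ∩ ⋃₀ 𝒪) := by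
    rw [← image_union, sdiff_union_inter]
  have hne : (K \ ⋃₀ 𝒪).Nonempty := by
    by_contra h
    rw [not_nonempty_iff_eq_empty.1 h, image_empty, empty_union] at hsplit
    exact hunc (hsplit ▸ h𝒪)
  obtain ⟨f, hf, hfK, hinj⟩ := exists_cantor_embedding_of_nowhere_const hp
    (hK.sdiff hopen) hne (by
      intro τ hτ U hU hτU
      obtain ⟨O, hO, hτO, hOU⟩ := (isBasis_countableBasis T).exists_subset_of_mem_open hτU hU
      by_contra! hconst
      refine hτ.2 ⟨O, ⟨hO, ?_⟩, hτO⟩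
      refine ((countable_singleton (p τ)).union h𝒪).mono ?_
      rintro _ ⟨σ, ⟨hσK, hσO⟩, rfl⟩
      by_cases hσ : σ ∈ ⋃₀ 𝒪
      · exact Or.inr ⟨σ, ⟨hσK, hσ⟩, rfl⟩
      · exact Or.inl (hconst σ ⟨⟨hσK, hσ⟩, hOU hσO⟩))
  exact ⟨f, hf, fun c => (hfK c).1, hinj⟩

end PerfectSet

section Universal

/-- There is a sequence of closed sets whose simultaneous sections are all the sequences of
closed sets. -/
theorem exists_universal_isClosed (X : Type*) [TopologicalSpace X] [SecondCountableTopology X] :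
    ∃ U : ℕ → Set ((ℕ → Bool) × X), (∀ n, IsClosed (U n)) ∧
      ∀ K : ℕ → Set X, (∀ n, IsClosed (K n)) → ∃ z, ∀ n x, (z, x) ∈ U n ↔ x ∈ K n := by
  classical
  obtain ⟨B, hB⟩ := ((countable_countableBasis X).insert ∅).exists_eq_range
    (Set.insert_nonempty _ _)
  have hBo : ∀ k, IsOpen (B k) := fun k => by
    rcases hB.symm ▸ Set.mem_range_self k with h | h
    · rw [h]; exact isOpen_empty
    · exact (isBasis_countableBasis X).isOpen h
  refine ⟨fun n => {q | ∀ k, q.1 (Nat.pair n k) = true → q.2 ∉ B k}, fun n => ?_,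
    fun K hK => ⟨fun m => decide (Disjoint (B m.unpair.2) (K m.unpair.1)), fun n x => ?_⟩⟩
  · simp only [Set.ofPred_forall, imp_iff_not_or, Set.ofPred_or]
    refine isClosed_iInter fun k => .union ?_ ((hBo k).isClosed_compl.preimage continuous_snd)
    have hc : Continuous fun q : (ℕ → Bool) × X => q.1 (Nat.pair n k) := by fun_prop
    exact (isClosed_discrete {b : Bool | ¬b = true}).preimage hc
  · simp only [Set.mem_ofPred_eq, Nat.unpair_pair, decide_eq_true_eq]
    refine ⟨fun h => ?_, fun hx k hk hxk => Set.disjoint_left.1 hk hxk hx⟩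
    by_contra hx
    obtain ⟨O, hO, hxO, hOK⟩ := (isBasis_countableBasis X).exists_subset_of_mem_open
      (show x ∈ (K n)ᶜ from hx) (hK n).isOpen_compl
    obtain ⟨k, rfl⟩ : O ∈ Set.range B := hB ▸ Or.inr hO
    exact h k (Set.disjoint_left.2 hOK) hxO

theorem MeasureTheory.AnalyticSet.exists_isClosed_proj {X : Type*} [TopologicalSpace X]
    [T2Space X] {A : Set X} (hA : AnalyticSet A) :
    ∃ K : Set (X × (ℕ → ℕ)), IsClosed K ∧ ∀ x, x ∈ A ↔ ∃ w, (x, w) ∈ K := by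
  rw [AnalyticSet] at hA
  rcases hA with rfl | ⟨k, hk, rfl⟩
  · exact ⟨∅, isClosed_empty, by simp⟩
  · exact ⟨{q | k q.2 = q.1}, isClosed_eq (by fun_prop) (by fun_prop), fun x => by simp⟩

end Universal

instance ContinuousMap.instPolishSpace {X Y : Type*} [TopologicalSpace X] [CompactSpace X]
    [SecondCountableTopology X] [LocallyCompactSpace X] [TopologicalSpace Y] [PolishSpace Y] :
    PolishSpace C(X, Y) := by
  let := upgradeIsCompletelyMetrizable Y
  infer_instance

section Scheme

open PiNat Set

/-- Prepending a bit, as a continuous self-map of the Cantor space. -/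
def cantorCons (i : Bool) : C(ℕ → Bool, ℕ → Bool) where
  toFun c n := Nat.casesOn n i c
  continuous_toFun := continuous_pi fun n => by
    cases n
    · exact continuous_const
    · exact continuous_apply _

theorem cantorCons_injective (i : Bool) : Function.Injective (cantorCons i) := fun _ _ h =>
  funext fun n => congrFun h (n + 1)

/-- The tree of maps obtained by alternately precomposing with maps provided by `step` and
restricting to the two halves of the Cantor space. -/
def cantorTree (step : ℕ → C(ℕ → Bool, ℕ → Bool) → C(ℕ → Bool, ℕ → Bool)) :
    List Bool → C(ℕ → Bool, ℕ → Bool)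
  | [] => ContinuousMap.id _
  | i :: l =>
    ((cantorTree step l).comp (step l.length (cantorTree step l))).comp (cantorCons i)

/-- The branches of the tree through a point. -/
def cantorBranches (step : ℕ → C(ℕ → Bool, ℕ → Bool) → C(ℕ → Bool, ℕ → Bool))
    (y : ℕ → Bool) : Set (ℕ → Bool) :=
  {c | ∀ n, y ∈ range (cantorTree step (res c n))}

variable {step : ℕ → C(ℕ → Bool, ℕ → Bool) → C(ℕ → Bool, ℕ → Bool)}

theorem range_cantorTree_cons_subset (i : Bool) (l : List Bool) :
    range (cantorTree step (i :: l)) ⊆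
      range (fun c => cantorTree step l (step l.length (cantorTree step l) c)) := by
  rintro _ ⟨c, rfl⟩
  exact ⟨cantorCons i c, rfl⟩

theorem cantorTree_injective (hstep : ∀ n ψ, Function.Injective (step n ψ)) (l : List Bool) :
    Function.Injective (cantorTree step l) := by
  induction l with
  | nil => exact Function.injective_id
  | cons i l ih => exact (ih.comp (hstep _ _)).comp (cantorCons_injective i)

theorem cantorBranches_subsingleton (hstep : ∀ n ψ, Function.Injective (step n ψ))
    (y : ℕ → Bool) : (cantorBranches step y).Subsingleton := by
  intro c hc d hd
  by_contra hne
  have hres : res c (firstDiff c d) = res d (firstDiff c d) :=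
    res_eq_res.2 fun m hm => apply_eq_of_lt_firstDiff hm
  obtain ⟨a, ha⟩ := hc (firstDiff c d + 1)
  obtain ⟨b, hb⟩ := hd (firstDiff c d + 1)
  rw [res_succ] at ha hb
  rw [← hres] at hb
  have := hstep _ _ (cantorTree_injective hstep _ (ha.trans hb.symm))
  exact apply_firstDiff_ne hne (congrFun this 0)

theorem isClosed_setOf_mem_cantorBranches :
    IsClosed {p : (ℕ → Bool) × (ℕ → Bool) | p.2 ∈ cantorBranches step p.1} := by
  have : {p : (ℕ → Bool) × (ℕ → Bool) | p.2 ∈ cantorBranches step p.1} =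
      ⋂ n, {p | p.1 ∈ range (cantorTree step (res p.2 n))} := by
    ext; simp [cantorBranches]
  rw [this]
  refine isClosed_iInter fun n => ?_
  rw [← isOpen_compl_iff]
  have : {p : (ℕ → Bool) × (ℕ → Bool) | p.1 ∈ range (cantorTree step (res p.2 n))}ᶜ =
      ⋃ c : ℕ → Bool, (range (cantorTree step (res c n)))ᶜ ×ˢ cylinder c n := by
    ext ⟨y, d⟩
    simp only [mem_compl_iff, mem_ofPred_eq, mem_iUnion, mem_prod, cylinder_eq_res]
    exact ⟨fun h => ⟨d, h, rfl⟩, fun ⟨c, h, hc⟩ => by rwa [hc]⟩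
  rw [this]
  exact isOpen_iUnion fun c =>
    ((isCompact_range (map_continuous _)).isClosed.isOpen_compl).prod (isOpen_cylinder _ _ _)

theorem exists_mem_cantorBranches (step : ℕ → C(ℕ → Bool, ℕ → Bool) → C(ℕ → Bool, ℕ → Bool))
    (c : ℕ → Bool) : ∃ y, c ∈ cantorBranches step y := by
  have := IsCompact.nonempty_iInter_of_sequence_nonempty_isCompact_isClosed
    (fun n => range (cantorTree step (res c n)))
    (fun n => by
      rw [res_succ]
      refine (range_cantorTree_cons_subset _ _).trans ?_
      rintro _ ⟨d, rfl⟩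
      exact ⟨_, rfl⟩)
    (fun n => range_nonempty _) (isCompact_range (map_continuous _))
    (fun n => (isCompact_range (map_continuous _)).isClosed)
  obtain ⟨y, hy⟩ := this
  exact ⟨y, mem_iInter.1 hy⟩

/-- The even and odd parts identify the Cantor space with its square. -/
def cantorMerge (x t : ℕ → Bool) : ℕ → Bool := fun n => if Even n then x (n / 2) else t (n / 2)

theorem cantorMerge_even (x t : ℕ → Bool) (n : ℕ) : cantorMerge x t (2 * n) = x n := by
  simp [cantorMerge]

theorem cantorMerge_odd (x t : ℕ → Bool) (n : ℕ) : cantorMerge x t (2 * n + 1) = t n := by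
  simp [cantorMerge, show (2 * n + 1) / 2 = n by omega]

theorem cantorMerge_even_odd (c : ℕ → Bool) :
    cantorMerge (fun n => c (2 * n)) (fun n => c (2 * n + 1)) = c := by
  ext n
  obtain ⟨m, rfl | rfl⟩ := n.even_or_odd'
  · rw [cantorMerge_even]
  · rw [cantorMerge_odd]

theorem continuous_cantorMerge (x : ℕ → Bool) : Continuous (cantorMerge x) :=
  continuous_pi fun n => by
    unfold cantorMerge
    split_ifs <;> fun_prop

/-- The combinatorial core: if every node of the tree is almost decided for each of the sets
`A n`, then there is a closed set, mapped onto the Cantor space by the odd part of the branch,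
on which that odd part decides all the `A n` continuously. -/
theorem exists_isClosed_continuous_decision (hstep : ∀ n ψ, Function.Injective (step n ψ))
    {A : ℕ → Set (ℕ → Bool)}
    (hA : ∀ n (ψ : C(ℕ → Bool, ℕ → Bool)),
      (∀ c, ψ (step n ψ c) ∈ A n) ∨ (A n ∩ range ψ).Countable) (τ : ℕ → Bool) :
    ∃ (F : Set (ℕ → Bool)) (g : (ℕ → Bool) → (ℕ → Bool)), IsClosed F ∧ Continuous g ∧
      (∀ t, ∃ y ∈ F, ∃ c ∈ cantorBranches step y, (fun n => c (2 * n + 1)) = t) ∧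
      ∀ y ∈ F, ∃ c ∈ cantorBranches step y, ∀ n,
        (g (fun n => c (2 * n + 1)) n = τ n ↔ y ∈ A n) := by
  classical
  let Solved : List Bool → Prop := fun l =>
    ∀ c, cantorTree step l (step l.length (cantorTree step l) c) ∈ A l.length
  have hbad : (⋃ l : List Bool, {x : ℕ → Bool | ¬Solved l ∧
      ∃ y ∈ A l.length ∩ range (cantorTree step l), ∃ c ∈ cantorBranches step y,
        (fun n => c (2 * n)) = x}).Countable := by
    refine countable_iUnion fun l => ?_
    by_cases hl : Solved l
    · simp [hl]
    have hcount := (hA l.length (cantorTree step l)).resolve_left hl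
    refine (hcount.biUnion (t := fun y _ => (fun c : ℕ → Bool => fun n => c (2 * n)) ''
      cantorBranches step y) fun y _ =>
        ((cantorBranches_subsingleton hstep y).image _).countable).mono ?_
    rintro x ⟨-, y, hy, c, hc, rfl⟩
    exact mem_biUnion hy ⟨c, hc, rfl⟩
  obtain ⟨x₀, hx₀⟩ : ∃ x₀, x₀ ∉ (⋃ l : List Bool, {x : ℕ → Bool | ¬Solved l ∧
      ∃ y ∈ A l.length ∩ range (cantorTree step l), ∃ c ∈ cantorBranches step y,
        (fun n => c (2 * n)) = x}) := by
    by_contra! h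
    have : Countable (ℕ → Bool) :=
      countable_univ_iff.1 (hbad.mono fun x _ => h x)
    obtain ⟨e, he⟩ := exists_surjective_nat (ℕ → Bool)
    obtain ⟨k, hk⟩ := he fun n => !e n n
    simpa using congrFun hk k
  let G : List Bool → Bool := fun l => if Solved l then τ l.length else !τ l.length
  refine ⟨Prod.fst '' ({p : (ℕ → Bool) × (ℕ → Bool) | p.2 ∈ cantorBranches step p.1} ∩
    {p | (fun n => p.2 (2 * n)) = x₀}), fun t n => G (res (cantorMerge x₀ t) n), ?_, ?_, ?_, ?_⟩
  · exact ((isClosed_setOf_mem_cantorBranches.inter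
      (isClosed_eq (by fun_prop) continuous_const)).isCompact.image continuous_fst).isClosed
  · refine continuous_pi fun n => ?_
    have hG : Continuous fun c : ℕ → Bool => G (res c n) := by
      refine (IsLocallyConstant.iff_exists_open _).2 (fun c => ?_) |>.continuous
      refine ⟨cylinder c n, isOpen_cylinder _ _ _, self_mem_cylinder _ _, fun d hd => ?_⟩
      rw [cylinder_eq_res] at hd
      rw [show res d n = res c n from hd]
    exact hG.comp (continuous_cantorMerge x₀)
  · intro t
    obtain ⟨y, hy⟩ := exists_mem_cantorBranches step (cantorMerge x₀ t)
    exact ⟨y, ⟨(y, cantorMerge x₀ t), ⟨hy, by simp [cantorMerge_even]⟩, rfl⟩,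
      cantorMerge x₀ t, hy, by simp [cantorMerge_odd]⟩
  · rintro _ ⟨⟨y, c⟩, ⟨hc, hx⟩, rfl⟩
    refine ⟨c, hc, fun n => ?_⟩
    have hmerge : cantorMerge x₀ (fun n => c (2 * n + 1)) = c := by
      rw [← show (fun n => c (2 * n)) = x₀ from hx, cantorMerge_even_odd]
    simp only [hmerge, G, res_length]
    by_cases hs : Solved (res c n)
    · rw [if_pos hs]
      refine iff_of_true rfl ?_
      obtain ⟨d, hd⟩ := range_cantorTree_cons_subset _ _ (hc (n + 1))
      have := hs d
      rwa [show cantorTree step (res c n) (step (res c n).length (cantorTree step (res c n)) d) = y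
        from hd, res_length] at this
    · rw [if_neg hs]
      refine iff_of_false (by simp) fun hy => hx₀ (mem_iUnion.2 ⟨res c n, hs, y, ⟨?_, hc n⟩, c,
        hc, hx⟩)
      rwa [res_length]

end Scheme

section MeasurableScheme

open PiNat Set

/-- Recorded because the search for `PolishSpace (ℕ → Bool)` does not find it otherwise. -/
instance : PolishSpace Bool := inferInstance

instance : MeasurableSpace C(ℕ → Bool, ℕ → Bool) := borel _

instance : BorelSpace C(ℕ → Bool, ℕ → Bool) := ⟨rfl⟩

theorem isOpen_setOf_forall_ne (n : ℕ) :
    IsOpen {χ : C(ℕ → Bool, ℕ → Bool) | ∀ c d : ℕ → Bool, c n ≠ d n → χ c ≠ χ d} := by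
  let S : Set (C(ℕ → Bool, ℕ → Bool) × ((ℕ → Bool) × (ℕ → Bool))) :=
    {q | q.2.1 n ≠ q.2.2 n ∧ q.1 q.2.1 = q.1 q.2.2}
  have hS : IsClosed S := by
    have h : Continuous fun q : C(ℕ → Bool, ℕ → Bool) × ((ℕ → Bool) × (ℕ → Bool)) =>
      (q.2.1 n, q.2.2 n) := by fun_prop
    exact ((isClosed_discrete {b : Bool × Bool | b.1 ≠ b.2}).preimage h).inter
      (isClosed_eq (by fun_prop) (by fun_prop))
  convert (isClosedMap_fst_of_compactSpace _ hS).isOpen_compl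
  ext χ
  simp [S]

theorem measurableSet_injective :
    MeasurableSet {χ : C(ℕ → Bool, ℕ → Bool) | Function.Injective χ} := by
  have : {χ : C(ℕ → Bool, ℕ → Bool) | Function.Injective χ} =
      ⋂ n, {χ | ∀ c d : ℕ → Bool, c n ≠ d n → χ c ≠ χ d} := by
    ext χ
    simp only [mem_ofPred_eq, mem_iInter]
    refine ⟨fun h n c d hne heq => hne (congrFun (h heq) n), fun h c d heq => ?_⟩
    by_contra hne
    obtain ⟨n, hn⟩ := Function.ne_iff.1 hne
    exact h n c d hn heq
  rw [this]
  exact MeasurableSet.iInter fun n => (isOpen_setOf_forall_ne n).measurableSet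

set_option synthInstance.maxSize 2000 in
theorem exists_measurable_step {T : Set ((ℕ → Bool) × (ℕ → Bool) × (ℕ → ℕ))}
    (hT : IsClosed T) :
    ∃ σ : (ℕ → Bool) × C(ℕ → Bool, ℕ → Bool) → C(ℕ → Bool, ℕ → Bool),
      Measurable[delta12 _] σ ∧ (∀ q, Function.Injective (σ q)) ∧
      ∀ z (ψ : C(ℕ → Bool, ℕ → Bool)), (∀ c, ∃ w, (z, ψ (σ (z, ψ) c), w) ∈ T) ∨
        ({y | ∃ w, (z, y, w) ∈ T} ∩ range ψ).Countable := by
  classical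
  let R₀ : Set ((((ℕ → Bool) × C(ℕ → Bool, ℕ → Bool)) × C(ℕ → Bool, ℕ → Bool)) ×
      C(ℕ → Bool, ℕ → ℕ)) :=
    {q | ∀ c, (q.1.1.1, q.1.1.2 (q.1.2 c), q.2 c) ∈ T}
  have hR₀ : IsClosed R₀ := by
    simp only [R₀, Set.ofPred_forall]
    exact isClosed_iInter fun c => hT.preimage (by fun_prop)
  let R : Set (((ℕ → Bool) × C(ℕ → Bool, ℕ → Bool)) × C(ℕ → Bool, ℕ → Bool)) :=
    {q | Function.Injective q.2 ∧ ∃ ω : C(ℕ → Bool, ℕ → ℕ), (q, ω) ∈ R₀}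
  have hR : AnalyticSet R := by
    have h₁ : AnalyticSet (Prod.fst '' R₀) := hR₀.analyticSet.image_of_continuous continuous_fst
    have h₂ := (measurableSet_injective.analyticSet).preimage (continuous_snd
      (X := (ℕ → Bool) × C(ℕ → Bool, ℕ → Bool)) (Y := C(ℕ → Bool, ℕ → Bool)))
    convert AnalyticSet.iInter (s := fun b : Bool => cond b
      (Prod.fst '' R₀) (Prod.snd ⁻¹' {χ | Function.Injective χ})) (fun b => by
        cases b
        · exact h₂
        · exact h₁) using 1
    ext q
    simp [R, and_comm]
  obtain ⟨φ, hφ, hφR⟩ := hR.exists_uniformization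
  have hdom : MeasurableSet[delta12 _] (Prod.fst '' R) :=
    (hR.image_of_continuous continuous_fst).measurableSet_delta12
  refine ⟨fun q => if q ∈ Prod.fst '' R then φ q else ContinuousMap.id _,
    Measurable.ite hdom hφ measurable_const, fun q => ?_, fun z ψ => ?_⟩
  · dsimp only
    split_ifs with h
    · obtain ⟨⟨q, χ⟩, hχ, rfl⟩ := h
      exact (hφR _ _ hχ).1
    · exact Function.injective_id
  · by_cases h : (z, ψ) ∈ Prod.fst '' R
    · simp only [if_pos h]
      obtain ⟨⟨q, χ⟩, hχ, rfl⟩ := h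
      obtain ⟨ω, hω⟩ := (hφR _ _ hχ).2
      exact Or.inl fun c => ⟨ω c, hω c⟩
    · right
      by_contra hunc
      have hK : IsClosed {q : (ℕ → Bool) × (ℕ → ℕ) | (z, ψ q.1, q.2) ∈ T} :=
        hT.preimage (by fun_prop)
      obtain ⟨f, hf, hfK, hinj⟩ := hK.exists_injective_comp_of_not_countable_image
        continuous_fst fun hc => hunc ((hc.image ψ).mono (by
          rintro _ ⟨⟨w, hw⟩, c, rfl⟩
          exact ⟨c, ⟨(c, w), hw, rfl⟩, rfl⟩))
      exact h ⟨((z, ψ), ⟨fun c => (f c).1, by fun_prop⟩), ⟨hinj,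
        ⟨fun c => (f c).2, by fun_prop⟩, hfK⟩, rfl⟩

variable {σ : ℕ → (ℕ → Bool) × C(ℕ → Bool, ℕ → Bool) → C(ℕ → Bool, ℕ → Bool)}

theorem measurable_cantorTree (hσ : ∀ n, Measurable[delta12 _] (σ n)) (l : List Bool) :
    Measurable[delta12 (ℕ → Bool)] fun z => cantorTree (fun n ψ => σ n (z, ψ)) l := by
  induction l with
  | nil => exact measurable_const
  | cons i l ih =>
    have hpair : Measurable[delta12 (ℕ → Bool)] fun z =>
        (z, cantorTree (fun n ψ => σ n (z, ψ)) l) :=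
      (Continuous.measurable_delta12 continuous_id).prodMk ih
    have hstep := (hσ l.length).comp hpair.measurable_delta12
    have hcomp : Continuous fun q : C(ℕ → Bool, ℕ → Bool) × C(ℕ → Bool, ℕ → Bool) =>
        (q.1.comp q.2).comp (cantorCons i) :=
      (continuous_fst.compCM continuous_snd).compCM continuous_const
    exact hcomp.measurable.comp (ih.prodMk hstep)

theorem sigma12_setOf_mem_cantorBranches (hσ : ∀ n, Measurable[delta12 _] (σ n)) :
    Sigma12 {p : ((ℕ → Bool) × (ℕ → Bool)) × (ℕ → Bool) |
      p.2 ∈ cantorBranches (fun n ψ => σ n (p.1.1, ψ)) p.1.2} := by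
  have hev : MeasurableSet {q : (ℕ → Bool) × C(ℕ → Bool, ℕ → Bool) | q.1 ∈ range q.2} := by
    have hcl : IsClosed {q : ((ℕ → Bool) × C(ℕ → Bool, ℕ → Bool)) × (ℕ → Bool) |
        q.1.2 q.2 = q.1.1} := isClosed_eq (by fun_prop) (by fun_prop)
    convert (isClosedMap_fst_of_compactSpace _ hcl).measurableSet
    ext q
    simp
  have hmem : ∀ l, MeasurableSet[delta12 (((ℕ → Bool) × (ℕ → Bool)) × (ℕ → Bool))]
      {p | p.1.2 ∈ range (cantorTree (fun n ψ => σ n (p.1.1, ψ)) l)} := by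
    intro l
    have h₁ := (measurable_cantorTree hσ l).comp (Continuous.measurable_delta12_delta12
      (f := fun p : ((ℕ → Bool) × (ℕ → Bool)) × (ℕ → Bool) => p.1.1) (by fun_prop))
    have h₂ := Continuous.measurable_delta12
      (f := fun p : ((ℕ → Bool) × (ℕ → Bool)) × (ℕ → Bool) => p.1.2) (by fun_prop)
    exact (h₂.prodMk h₁) hev
  have hcyl : ∀ n l, MeasurableSet[delta12 (((ℕ → Bool) × (ℕ → Bool)) × (ℕ → Bool))]
      {p | res p.2 n = l} := by
    intro n l
    refine borel_le_delta12
      (X := ((ℕ → Bool) × (ℕ → Bool)) × (ℕ → Bool)) _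
      (MeasurableSpace.measurableSet_generateFrom ?_)
    refine IsOpen.preimage (t := {c : ℕ → Bool | res c n = l}) continuous_snd
      (isOpen_iff_mem_nhds.2 fun c hc => Filter.mem_of_superset
        ((isOpen_cylinder (fun _ => Bool) c n).mem_nhds (self_mem_cylinder _ _)) fun d hd => ?_)
    rw [cylinder_eq_res] at hd
    exact Eq.trans hd hc
  have : {p : ((ℕ → Bool) × (ℕ → Bool)) × (ℕ → Bool) |
      p.2 ∈ cantorBranches (fun n ψ => σ n (p.1.1, ψ)) p.1.2} =
      ⋂ n, ⋃ l, {p | res p.2 n = l} ∩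
        {p | p.1.2 ∈ range (cantorTree (fun n ψ => σ n (p.1.1, ψ)) l)} := by
    ext p
    simp [cantorBranches]
  rw [this]
  exact (MeasurableSet.iInter fun n => MeasurableSet.iUnion fun l =>
    (hcyl n l).inter (hmem l)).1

end MeasurableScheme

/-- There is a `(Σ¹₂,Σ¹₁∪Π¹₁)`-expansion of the Cantor space with `Y' = 2^ℕ × 2^ℕ`:
a `Σ¹₂` set `E ⊆ 2^ℕ × 2^ℕ` and a `Σ¹₂`-measurable `r : E → 2^ℕ` such that every
`Σ¹₁∪Π¹₁`-submeasurable `f : 2^ℕ × 2^ℕ → 2^ℕ` factors continuously through `r`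
on a closed subset of `E` mapping onto `2^ℕ`. -/
theorem statement9 :
    ∃ (E : Set ((ℕ → Bool) × (ℕ → Bool))) (r : (ℕ → Bool) × (ℕ → Bool) → (ℕ → Bool)),
      Sigma12 E ∧
      (∀ V : Set (ℕ → Bool), IsOpen V → ∃ S, Sigma12 S ∧ r ⁻¹' V ∩ E = S ∩ E) ∧
      ∀ f : (ℕ → Bool) × (ℕ → Bool) → (ℕ → Bool), CantorSubmeasurable f →
        ∃ (F : Set ((ℕ → Bool) × (ℕ → Bool))) (g : (ℕ → Bool) → (ℕ → Bool)),
          F ⊆ E ∧ IsClosed F ∧ Continuous g ∧ r '' F = Set.univ ∧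
          ∀ w ∈ F, g (r w) = f w := by
  classical
  obtain ⟨U, hU, hUuniv⟩ := exists_universal_isClosed (((ℕ → Bool) × (ℕ → Bool)) × (ℕ → ℕ))
  have hT : ∀ n, IsClosed {q : (ℕ → Bool) × (ℕ → Bool) × (ℕ → ℕ) |
      (q.1, (q.1, q.2.1), q.2.2) ∈ U n} := fun n => (hU n).preimage (by fun_prop)
  choose σ hσ hσinj hσT using fun n => exists_measurable_step (hT n)
  let B : (ℕ → Bool) × (ℕ → Bool) → Set (ℕ → Bool) := fun w =>
    cantorBranches (fun n ψ => σ n (w.1, ψ)) w.2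
  have hBsub : ∀ w, (B w).Subsingleton := fun w =>
    cantorBranches_subsingleton (fun n ψ => hσinj n _) w.2
  have hB : Sigma12 {p : ((ℕ → Bool) × (ℕ → Bool)) × (ℕ → Bool) | p.2 ∈ B p.1} :=
    sigma12_setOf_mem_cantorBranches hσ
  obtain ⟨r, hr⟩ : ∃ r : (ℕ → Bool) × (ℕ → Bool) → (ℕ → Bool),
      ∀ w, ∀ c ∈ B w, r w = fun n => c (2 * n + 1) := by
    refine ⟨fun w => if h : (B w).Nonempty then fun n => h.some (2 * n + 1) else fun _ => true,
      fun w c hc => ?_⟩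
    have h : (B w).Nonempty := ⟨c, hc⟩
    simp only [dif_pos h, hBsub w h.some_mem hc]
  refine ⟨{w | (B w).Nonempty}, r, ?_, fun V hV => ?_, fun f hf => ?_⟩
  · convert hB.image continuous_fst
    ext w
    simp [Set.Nonempty]
  · have hO : IsOpen {p : ((ℕ → Bool) × (ℕ → Bool)) × (ℕ → Bool) |
        (fun n => p.2 (2 * n + 1)) ∈ V} := hV.preimage (by fun_prop)
    refine ⟨_, (hB.inter (Sigma12.of_analytic
      (by simpa using hO.analyticSet_image continuous_id))).image continuous_fst, ?_⟩
    ext w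
    constructor
    · rintro ⟨hw, c, hc⟩
      rw [Set.mem_preimage, hr w c hc] at hw
      exact ⟨⟨(w, c), ⟨hc, hw⟩, rfl⟩, c, hc⟩
    · rintro ⟨⟨⟨w, c⟩, ⟨hc, hw⟩, rfl⟩, hE⟩
      refine ⟨?_, hE⟩
      rw [Set.mem_preimage, hr w c hc]
      exact hw
  · have hsub : ∀ n, ∃ b, AnalyticSet (f ⁻¹' {x | x n = b}) := by
      intro n
      rcases hf n true with h | h
      · exact ⟨true, h⟩
      · refine ⟨false, ?_⟩
        convert h
        ext w
        simp
    choose τ hτ using hsub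
    choose K hK hKf using fun n => (hτ n).exists_isClosed_proj
    obtain ⟨z, hz⟩ := hUuniv K hK
    have hmem : ∀ n y, (∃ w, (z, (z, y), w) ∈ U n) ↔ f (z, y) n = τ n := by
      intro n y
      simp only [hz, ← hKf]
      rfl
    obtain ⟨F, g, hF, hg, hsurj, hdec⟩ := exists_isClosed_continuous_decision
      (step := fun n ψ => σ n (z, ψ)) (A := fun n => {y | f (z, y) n = τ n})
      (fun n ψ => hσinj n _) (fun n ψ => by simpa [hmem] using hσT n z ψ) τ
    refine ⟨{z} ×ˢ F, g, ?_, isClosed_singleton.prod hF, hg, ?_, ?_⟩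
    · rintro ⟨_, y⟩ ⟨rfl, hy⟩
      obtain ⟨c, hc, -⟩ := hdec y hy
      exact ⟨c, hc⟩
    · refine Set.eq_univ_of_forall fun t => ?_
      obtain ⟨y, hy, c, hc, rfl⟩ := hsurj t
      exact ⟨(z, y), ⟨rfl, hy⟩, hr _ c hc⟩
    · rintro ⟨_, y⟩ ⟨rfl, hy⟩
      obtain ⟨c, hc, hgc⟩ := hdec y hy
      rw [hr _ c hc]
      ext n
      have := hgc n
      simp only [Set.mem_ofPred_eq] at this
      revert this
      generalize g _ n = a
      generalize f _ n = b
      generalize τ n = d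
      revert a b d
      decide
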